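/- Under hypotheses (H0)-(H4), for any a ∈ D one has E_z[exp(a·Z(τ)); τ < ∞] = exp(ā·z) for every z ∈ ℤ^{d−1}×ℕ*, and E_z[exp(a·Z(τ)); τ < ∞] = exp(ā·z)·φ₀(ā) for every z ∈ ℤ^{d−1}×{0}. -/

import Mathlib

open scoped ENNReal
open Filter MeasureTheory

namespace ReflectedRW

/-- `ℤ^d` realized as `ℤ^{d-1} × ℤ`. -/
abbrev Zd (d : ℕ) := (Fin (d-1) → ℤ) × ℤ
/-- `ℝ^d` realized as `ℝ^{d-1} × ℝ`. -/
abbrev Rd (d : ℕ) := (Fin (d-1) → ℝ) × ℝ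
/-- The state space `ℤ^{d-1} × ℕ` of the reflected walk. -/
abbrev St (d : ℕ) := (Fin (d-1) → ℤ) × ℕ

/-- Embedding of the state space into `ℤ^d`. -/
def toZ (d : ℕ) (z : St d) : Zd d := (z.1, (z.2 : ℤ))

/-- Embedding of `ℤ^d` into `ℝ^d`. -/
def toR (d : ℕ) (z : Zd d) : Rd d := (fun i => (z.1 i : ℝ), (z.2 : ℝ))

/-- Scalar product `a · z` of `a ∈ ℝ^d` and `z ∈ ℤ^d`. -/
noncomputable def dotZ (d : ℕ) (a : Rd d) (z : Zd d) : ℝ :=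
  (∑ i, a.1 i * (z.1 i : ℝ)) + a.2 * (z.2 : ℝ)

/-- Scalar product on `ℝ^d`. -/
noncomputable def dotR (d : ℕ) (a q : Rd d) : ℝ :=
  (∑ i, a.1 i * q.1 i) + a.2 * q.2

/-- One-step transition probabilities of the reflected random walk `Z(t)`:
jumps with law `μ` in the interior and with law `μ0` on the boundary `y = 0`. -/
noncomputable def step (d : ℕ) (μ μ0 : Zd d → ℝ) (z z' : St d) : ℝ≥0∞ :=
  if z.2 = 0 then ENNReal.ofReal (μ0 (toZ d z' - toZ d z))
  else ENNReal.ofReal (μ (toZ d z' - toZ d z))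

/-- Real-valued version of the transition kernel of `Z(t)`. -/
noncomputable def stepR (d : ℕ) (μ μ0 : Zd d → ℝ) (z z' : St d) : ℝ :=
  if z.2 = 0 then μ0 (toZ d z' - toZ d z) else μ (toZ d z' - toZ d z)

/-- `n`-step kernel obtained by iterating a sub-Markov kernel `p`. -/
noncomputable def kerIter {S : Type*} [DecidableEq S] (p : S → S → ℝ≥0∞) :
    ℕ → S → S → ℝ≥0∞
  | 0, z, z' => if z = z' then 1 else 0
  | n+1, z, z' => ∑' w : S, kerIter p n z w * p w z'

/-- `n`-step transition probabilities of `Z(t)`: `P_z(Z(n) = z')`. -/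
noncomputable def stepn (d : ℕ) (μ μ0 : Zd d → ℝ) : ℕ → St d → St d → ℝ≥0∞ :=
  kerIter (step d μ μ0)

/-- Green's function `G(z,z') = ∑_{t ≥ 0} P_z(Z(t) = z')` of the reflected walk. -/
noncomputable def green (d : ℕ) (μ μ0 : Zd d → ℝ) (z z' : St d) : ℝ≥0∞ :=
  ∑' n : ℕ, stepn d μ μ0 n z z'

/-- Kernel of the walk killed upon hitting the boundary hyperplane `y = 0`. -/
noncomputable def stepKilled (d : ℕ) (μ μ0 : Zd d → ℝ) (z z' : St d) : ℝ≥0∞ :=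
  if z'.2 = 0 then 0 else step d μ μ0 z z'

/-- `n`-step kernel of the killed walk: `P_z(Z(n) = z', τ > n)` where
`τ` is the first return time to the boundary hyperplane. -/
noncomputable def stepKilledn (d : ℕ) (μ μ0 : Zd d → ℝ) : ℕ → St d → St d → ℝ≥0∞ :=
  kerIter (stepKilled d μ μ0)

/-- Green's function `G₊(z,z')` of the killed walk. -/
noncomputable def greenPlus (d : ℕ) (μ μ0 : Zd d → ℝ) (z z' : St d) : ℝ≥0∞ :=
  ∑' n : ℕ, stepKilledn d μ μ0 n z z'

/-- One-step kernel of the homogeneous random walk `S(t)` on `ℤ^d`. -/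
noncomputable def stepS (d : ℕ) (μ : Zd d → ℝ) (z z' : Zd d) : ℝ≥0∞ :=
  ENNReal.ofReal (μ (z' - z))

/-- `n`-step kernel of the homogeneous random walk on `ℤ^d`. -/
noncomputable def stepSn (d : ℕ) (μ : Zd d → ℝ) : ℕ → Zd d → Zd d → ℝ≥0∞ :=
  kerIter (stepS d μ)

/-- Green's function `G_S` of the homogeneous random walk on `ℤ^d`. -/
noncomputable def greenS (d : ℕ) (μ : Zd d → ℝ) (z z' : Zd d) : ℝ≥0∞ :=
  ∑' n : ℕ, stepSn d μ n z z'

/-- `hitProb z w = P_z(τ < ∞, Z(τ) = w)`, the hitting distribution on the boundary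
hyperplane, `τ = inf{t ≥ 1 : Z(t) ∈ ℤ^{d-1}×{0}}`. -/
noncomputable def hitProb (d : ℕ) (μ μ0 : Zd d → ℝ) (z w : St d) : ℝ≥0∞ :=
  if w.2 = 0 then
    ∑' n : ℕ, ∑' v : St d, stepKilledn d μ μ0 n z v * step d μ μ0 v w
  else 0

/-- The jump generating function `φ(a) = ∑_z μ(z) e^{a·z}`. -/
noncomputable def jgf (d : ℕ) (μ : Zd d → ℝ) (a : Rd d) : ℝ :=
  ∑' z : Zd d, μ z * Real.exp (dotZ d a z)

/-- Partial derivative `∂φ/∂β` of the jump generating function in the last coordinate. -/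
noncomputable def jgfDβ (d : ℕ) (μ : Zd d → ℝ) (a : Rd d) : ℝ :=
  ∑' z : Zd d, μ z * (z.2 : ℝ) * Real.exp (dotZ d a z)

/-- Gradient `∇φ(a)` of the jump generating function. -/
noncomputable def jgfGrad (d : ℕ) (μ : Zd d → ℝ) (a : Rd d) : Rd d :=
  (fun i => ∑' z : Zd d, μ z * (z.1 i : ℝ) * Real.exp (dotZ d a z), jgfDβ d μ a)

/-- The set `D = {a : φ(a) ≤ 1}`. -/
def Dset (d : ℕ) (μ : Zd d → ℝ) : Set (Rd d) := {a | jgf d μ a ≤ 1}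

/-- `∂₊D`: points of the boundary of `D` where the last coordinate of `∇φ` is `≥ 0`. -/
def bdPlus (d : ℕ) (μ : Zd d → ℝ) : Set (Rd d) :=
  {a | jgf d μ a = 1 ∧ 0 ≤ jgfDβ d μ a}

/-- `∂₋D`: points of the boundary of `D` where the last coordinate of `∇φ` is `≤ 0`. -/
def bdMinus (d : ℕ) (μ : Zd d → ℝ) : Set (Rd d) :=
  {a | jgf d μ a = 1 ∧ jgfDβ d μ a ≤ 0}

/-- `∂₀D`: points of the boundary of `D` where the last coordinate of `∇φ` is `0`. -/
def bdZero (d : ℕ) (μ : Zd d → ℝ) : Set (Rd d) :=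
  {a | jgf d μ a = 1 ∧ jgfDβ d μ a = 0}

/-- `Θ = {α ∈ ℝ^{d-1} : inf_β max(φ(α,β), φ₀(α,β)) ≤ 1}`. -/
noncomputable def Theta (d : ℕ) (μ μ0 : Zd d → ℝ) : Set (Fin (d-1) → ℝ) :=
  {α | (⨅ β : ℝ, max (jgf d μ (α, β)) (jgf d μ0 (α, β))) ≤ 1}

/-- `D̂ = (Θ×ℝ) ∩ D`. -/
noncomputable def Dhat (d : ℕ) (μ μ0 : Zd d → ℝ) : Set (Rd d) :=
  {a | a.1 ∈ Theta d μ μ0 ∧ jgf d μ a ≤ 1}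

/-- Normal cone to a convex set `s ⊆ ℝ^d` at the point `a`. -/
noncomputable def normalCone (d : ℕ) (s : Set (Rd d)) (a : Rd d) : Set (Rd d) :=
  {q | ∀ b ∈ s, dotR d q (b - a) ≤ 0}

/-- The mean vector `m = ∑_z z μ(z)`. -/
noncomputable def meanVec (d : ℕ) (μ : Zd d → ℝ) : Rd d :=
  (fun i => ∑' z : Zd d, μ z * (z.1 i : ℝ), ∑' z : Zd d, μ z * (z.2 : ℝ))

/-- The harmonic functions `h_a` of (1-8), for `a ∈ D̂ ∩ ∂₊D` with associated
point `abar = ā ∈ ∂₋D` (same first `d-1` coordinates as `a`). -/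
noncomputable def hfun (d : ℕ) (μ μ0 : Zd d → ℝ) (a abar : Rd d) (z : St d) : ℝ :=
  if jgf d μ0 abar = 1 then Real.exp (dotZ d abar (toZ d z))
  else if a = abar then
    (z.2 : ℝ) * Real.exp (dotZ d a (toZ d z))
      + (jgfDβ d μ0 a / (1 - jgf d μ0 a)) * Real.exp (dotZ d a (toZ d z))
  else
    Real.exp (dotZ d a (toZ d z))
      - ((1 - jgf d μ0 a) / (1 - jgf d μ0 abar)) * Real.exp (dotZ d abar (toZ d z))

/-- `h : ℤ^{d-1}×ℕ → ℝ` is harmonic for the reflected walk. -/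
def IsHarmonic (d : ℕ) (μ μ0 : Zd d → ℝ) (h : St d → ℝ) : Prop :=
  ∀ z : St d, HasSum (fun z' => stepR d μ μ0 z z' * h z') (h z)

/-- Minimal nonnegative harmonic function. -/
def IsMinimalHarmonic (d : ℕ) (μ μ0 : Zd d → ℝ) (h : St d → ℝ) : Prop :=
  IsHarmonic d μ μ0 h ∧ (∀ z, 0 ≤ h z) ∧ h ≠ 0 ∧
    ∀ h' : St d → ℝ, IsHarmonic d μ μ0 h' → (∀ z, 0 ≤ h' z) → h' ≠ 0 →
      (∀ z, h' z ≤ h z) → ∃ c : ℝ, 0 < c ∧ h' = fun z => c * h z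

/- Hypotheses (H0)–(H4). -/

/-- `(H0)`: `μ(x,y) = 0` for `y < -1` and `μ₀(x,y) = 0` for `y < 0`. -/
def H0 (d : ℕ) (μ μ0 : Zd d → ℝ) : Prop :=
  (∀ z : Zd d, z.2 < -1 → μ z = 0) ∧ (∀ z : Zd d, z.2 < 0 → μ0 z = 0)

/-- `(H1)`: the reflected walk is irreducible on `ℤ^{d-1}×ℕ`. -/
def H1 (d : ℕ) (μ μ0 : Zd d → ℝ) : Prop :=
  ∀ z z' : St d, ∃ n : ℕ, 0 < stepn d μ μ0 n z z'

/-- `(H2)`: the homogeneous walk with step law `μ` is irreducible on `ℤ^d` and its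
last coordinate is an aperiodic random walk on `ℤ`. -/
def H2 (d : ℕ) (μ : Zd d → ℝ) : Prop :=
  (∀ z z' : Zd d, ∃ n : ℕ, 0 < stepSn d μ n z z') ∧
    AddSubgroup.closure {y : ℤ | ∃ x : Fin (d-1) → ℤ, μ (x, y) ≠ 0} = ⊤

/-- `(H3)`: `m ≠ 0` and `m/|m| + m₀/|m₀| ≠ 0`. -/
noncomputable def H3 (d : ℕ) (μ μ0 : Zd d → ℝ) : Prop :=
  meanVec d μ ≠ 0 ∧ meanVec d μ0 ≠ 0 ∧
    ‖meanVec d μ‖⁻¹ • meanVec d μ + ‖meanVec d μ0‖⁻¹ • meanVec d μ0 ≠ 0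

/-- `(H4)`: the jump generating functions are finite everywhere on `ℝ^d`. -/
def H4 (d : ℕ) (μ μ0 : Zd d → ℝ) : Prop :=
  ∀ a : Rd d, Summable (fun z : Zd d => μ z * Real.exp (dotZ d a z)) ∧
    Summable (fun z : Zd d => μ0 z * Real.exp (dotZ d a z))

/-- `μ` is a probability distribution on `ℤ^d`. -/
def IsProb (d : ℕ) (μ : Zd d → ℝ) : Prop :=
  (∀ z : Zd d, 0 ≤ μ z) ∧ HasSum μ 1



section

variable {d : ℕ} {μ μ0 : Zd d → ℝ}

/-- The action of a kernel `p` on functions. -/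
noncomputable def kerApply {S : Type*} (p : S → S → ℝ≥0∞) (f : S → ℝ≥0∞) (z : S) : ℝ≥0∞ :=
  ∑' w, p z w * f w

lemma kerApply_mono {S : Type*} (p : S → S → ℝ≥0∞) {f g : S → ℝ≥0∞} {z : S}
    (h : ∀ w, p z w ≠ 0 → f w ≤ g w) : kerApply p f z ≤ kerApply p g z := by
  refine ENNReal.tsum_le_tsum fun w => ?_
  by_cases hw : p z w = 0
  · simp [hw]
  · exact mul_le_mul_right (h w hw) _

lemma kerApply_add {S : Type*} (p : S → S → ℝ≥0∞) (f g : S → ℝ≥0∞) (z : S) :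
    kerApply p (fun w => f w + g w) z = kerApply p f z + kerApply p g z := by
  simp only [kerApply, mul_add, ENNReal.tsum_add]

lemma kerApply_tsum {S ι : Type*} (p : S → S → ℝ≥0∞) (f : ι → S → ℝ≥0∞) (z : S) :
    kerApply p (fun w => ∑' i, f i w) z = ∑' i, kerApply p (f i) z := by
  simp only [kerApply, ← ENNReal.tsum_mul_left]
  exact ENNReal.tsum_comm

lemma tsum_kerIter_mul {S : Type*} [DecidableEq S] (p : S → S → ℝ≥0∞) (n : ℕ)
    (f : S → ℝ≥0∞) (z : S) :
    ∑' v, kerIter p n z v * f v = (kerApply p)^[n] f z := by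
  induction n generalizing f with
  | zero =>
    rw [tsum_eq_single z]
    · simp [kerIter]
    · intro b hb
      simp [kerIter, hb.symm]
  | succ n ih =>
    rw [Function.iterate_succ_apply, ← ih]
    simp only [kerIter, kerApply, ← ENNReal.tsum_mul_right, ← ENNReal.tsum_mul_left, mul_assoc]
    exact ENNReal.tsum_comm

/-- The potential `∑ₙ pⁿ f` solves the Poisson equation. -/
lemma tsum_iterate_kerApply {S : Type*} (p : S → S → ℝ≥0∞) (f : S → ℝ≥0∞) (z : S) :
    ∑' n, (kerApply p)^[n] f z = f z + kerApply p (fun w => ∑' n, (kerApply p)^[n] f w) z := by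
  rw [kerApply_tsum, tsum_eq_zero_add' ENNReal.summable]
  simp only [Function.iterate_zero, id, Function.iterate_succ_apply']

/-- The potential `∑ₙ pⁿ f` is the least supersolution of the Poisson equation. -/
lemma tsum_iterate_kerApply_le {S : Type*} (p : S → S → ℝ≥0∞) (f h : S → ℝ≥0∞)
    (A : Set S) (hp : ∀ z w, p z w ≠ 0 → w ∈ A)
    (hh : ∀ z ∈ A, f z + kerApply p h z ≤ h z) :
    ∀ z ∈ A, ∑' n, (kerApply p)^[n] f z ≤ h z := by
  intro z hz
  rw [ENNReal.tsum_eq_iSup_nat]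
  refine iSup_le fun N => ?_
  induction N generalizing z with
  | zero => simp
  | succ N ih =>
    rw [Finset.sum_range_succ']
    refine le_trans (le_of_eq ?_) ((add_le_add_right (kerApply_mono p
      (f := fun w => ∑ n ∈ Finset.range N, (kerApply p)^[n] f w)
      fun w hw => ih w (hp z w hw)) (f z)).trans (hh z hz))
    rw [add_comm]
    simp only [Function.iterate_zero, id, Function.iterate_succ_apply', kerApply,
      Finset.mul_sum]
    rw [Summable.tsum_finsetSum fun _ _ => ENNReal.summable]

/-- The exponential function `z ↦ e^{b·z}` with values in `[0,∞]`. -/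
noncomputable def expDot (d : ℕ) (b : Rd d) (z : Zd d) : ℝ≥0∞ :=
  ENNReal.ofReal (Real.exp (dotZ d b z))

lemma dotZ_add (b : Rd d) (k z : Zd d) : dotZ d b (k + z) = dotZ d b k + dotZ d b z := by
  simp only [dotZ, Prod.fst_add, Prod.snd_add, Pi.add_apply, Int.cast_add, mul_add,
    Finset.sum_add_distrib]
  ring

lemma dotZ_add_left (b c : Rd d) (z : Zd d) : dotZ d (b + c) z = dotZ d b z + dotZ d c z := by
  simp only [dotZ, Prod.fst_add, Prod.snd_add, Pi.add_apply, add_mul,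
    Finset.sum_add_distrib]
  ring

lemma expDot_add (b : Rd d) (k z : Zd d) :
    expDot d b (k + z) = expDot d b k * expDot d b z := by
  rw [expDot, dotZ_add, Real.exp_add, ENNReal.ofReal_mul (Real.exp_pos _).le, expDot, expDot]

lemma expDot_ne_zero (b : Rd d) (z : Zd d) : expDot d b z ≠ 0 := by
  simp [expDot, Real.exp_pos]

lemma expDot_ne_top (b : Rd d) (z : Zd d) : expDot d b z ≠ ∞ := ENNReal.ofReal_ne_top

lemma toZ_injective : Function.Injective (toZ d) := by
  rintro ⟨x, y⟩ ⟨x', y'⟩ h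
  simpa [toZ] using h

/-- Reindexing a sum over the half-space by the jump, for jumps which cannot leave it. -/
lemma tsum_jump (ν : Zd d → ℝ) (z : St d) (hν : ∀ k : Zd d, k.2 < -(z.2 : ℤ) → ν k = 0)
    (f : Zd d → ℝ≥0∞) :
    ∑' w : St d, ENNReal.ofReal (ν (toZ d w - toZ d z)) * f (toZ d w)
      = ∑' k : Zd d, ENNReal.ofReal (ν k) * f (k + toZ d z) := by
  rw [toZ_injective.tsum_eq (f := fun v => ENNReal.ofReal (ν (v - toZ d z)) * f v),
    ← (Equiv.addRight (toZ d z)).tsum_eq]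
  · simp
  · intro v hv
    by_contra hr
    refine hv ?_
    have h2 : v.2 < 0 := by
      by_contra h
      exact hr ⟨(v.1, v.2.toNat), by ext <;> simp [toZ]; omega⟩
    have : ν (v - toZ d z) = 0 := hν _ (by simp [toZ]; omega)
    simp [this]

lemma tsum_ofReal_mul_expDot {ν : Zd d → ℝ} (hν : ∀ k, 0 ≤ ν k) {b : Rd d}
    (hs : Summable fun k : Zd d => ν k * Real.exp (dotZ d b k)) :
    ∑' k, ENNReal.ofReal (ν k) * expDot d b k = ENNReal.ofReal (jgf d ν b) := by
  rw [jgf, ENNReal.ofReal_tsum_of_nonneg (fun k => mul_nonneg (hν k) (Real.exp_pos _).le) hs]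
  simp only [expDot, ENNReal.ofReal_mul (hν _)]

lemma kerApply_step_expDot_interior (hμ : ∀ k, 0 ≤ μ k) (hH0 : H0 d μ μ0) {b : Rd d}
    (hs : Summable fun k : Zd d => μ k * Real.exp (dotZ d b k)) (hb : jgf d μ b = 1)
    {z : St d} (hz : z.2 ≠ 0) :
    kerApply (step d μ μ0) (fun w => expDot d b (toZ d w)) z = expDot d b (toZ d z) := by
  simp only [kerApply, step, hz, if_false]
  rw [tsum_jump μ z (fun k hk => hH0.1 k (by omega)) (expDot d b)]
  simp only [expDot_add, ← mul_assoc, ENNReal.tsum_mul_right]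
  rw [tsum_ofReal_mul_expDot hμ hs, hb, ENNReal.ofReal_one, one_mul]

lemma kerApply_step_expDot_boundary (hμ0 : ∀ k, 0 ≤ μ0 k) (hH0 : H0 d μ μ0) {b : Rd d}
    (hs : Summable fun k : Zd d => μ0 k * Real.exp (dotZ d b k))
    {z : St d} (hz : z.2 = 0) :
    kerApply (step d μ μ0) (fun w => expDot d b (toZ d w)) z
      = expDot d b (toZ d z) * ENNReal.ofReal (jgf d μ0 b) := by
  simp only [kerApply, step, hz, if_true]
  rw [tsum_jump μ0 z (fun k hk => hH0.2 k (by omega)) (expDot d b)]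
  simp only [expDot_add, ← mul_assoc, ENNReal.tsum_mul_right]
  rw [tsum_ofReal_mul_expDot hμ0 hs, mul_comm]

lemma summable_snd_mul_exp (hμ : ∀ k, 0 ≤ μ k)
    (hs : ∀ b : Rd d, Summable fun k : Zd d => μ k * Real.exp (dotZ d b k)) (b : Rd d) :
    Summable fun k : Zd d => μ k * (k.2 : ℝ) * Real.exp (dotZ d b k) := by
  refine Summable.of_norm_bounded ((hs (b + (0, 1))).add (hs (b + (0, -1)))) fun k => ?_
  have h1 : dotZ d ((0, 1) : Rd d) k = k.2 := by simp [dotZ]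
  have h2 : dotZ d ((0, -1) : Rd d) k = -k.2 := by simp [dotZ]
  rw [dotZ_add_left, dotZ_add_left, h1, h2, Real.exp_add, Real.exp_add, norm_mul, norm_mul,
    Real.norm_eq_abs, Real.norm_eq_abs, Real.norm_eq_abs, abs_of_nonneg (hμ k), Real.abs_exp]
  have hk : |(k.2 : ℝ)| ≤ Real.exp k.2 + Real.exp (-k.2) := by
    have p1 := Real.add_one_le_exp (k.2 : ℝ)
    have p2 := Real.add_one_le_exp (-k.2 : ℝ)
    have p3 := Real.exp_pos (k.2 : ℝ)
    have p4 := Real.exp_pos (-k.2 : ℝ)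
    rcases abs_cases (k.2 : ℝ) with h | h <;> linarith
  have := mul_le_mul_of_nonneg_left hk (mul_nonneg (hμ k) (Real.exp_pos (dotZ d b k)).le)
  linarith

/-- Under the law tilted by `b ∈ ∂₋D` the last coordinate is a supermartingale. -/
lemma kerApply_step_snd_le (hμ : ∀ k, 0 ≤ μ k) (hH0 : H0 d μ μ0)
    (hs : ∀ b : Rd d, Summable fun k : Zd d => μ k * Real.exp (dotZ d b k)) {b : Rd d}
    (hb : b ∈ bdMinus d μ) {z : St d} (hz : z.2 ≠ 0) :
    kerApply (step d μ μ0) (fun w => expDot d b (toZ d w) * (w.2 : ℝ≥0∞)) z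
      ≤ expDot d b (toZ d z) * (z.2 : ℝ≥0∞) := by
  have hcast : ∀ w : St d, (w.2 : ℝ≥0∞) = ENNReal.ofReal (((toZ d w).2 : ℤ) : ℝ) := by
    intro w
    simp [toZ]
  simp only [kerApply, step, hz, if_false, hcast]
  rw [tsum_jump μ z (fun k hk => hH0.1 k (by omega))
    (fun v => expDot d b v * ENNReal.ofReal (v.2 : ℝ))]
  have hterm : ∀ k : Zd d, ENNReal.ofReal (μ k) *
      (expDot d b (k + toZ d z) * ENNReal.ofReal (((k + toZ d z).2 : ℤ) : ℝ))
      = ENNReal.ofReal (μ k * (k.2 : ℝ) * Real.exp (dotZ d b k)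
          + z.2 * (μ k * Real.exp (dotZ d b k))) * expDot d b (toZ d z) := by
    intro k
    rw [expDot_add]
    have : μ k * (k.2 : ℝ) * Real.exp (dotZ d b k) + z.2 * (μ k * Real.exp (dotZ d b k))
        = μ k * Real.exp (dotZ d b k) * (((k + toZ d z).2 : ℤ) : ℝ) := by
      simp [toZ]
      ring
    rw [this, ENNReal.ofReal_mul (mul_nonneg (hμ k) (Real.exp_pos _).le),
      ENNReal.ofReal_mul (hμ k), expDot]
    ring
  have hnn : ∀ k : Zd d, 0 ≤ μ k * (k.2 : ℝ) * Real.exp (dotZ d b k)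
          + z.2 * (μ k * Real.exp (dotZ d b k)) := by
    intro k
    by_cases hk : k.2 < -1
    · simp [hH0.1 k hk]
    · have h1 : (0 : ℤ) ≤ k.2 + z.2 := by omega
      have h2 : (0 : ℝ) ≤ (k.2 : ℝ) + z.2 := by exact_mod_cast h1
      have := mul_nonneg (mul_nonneg (hμ k) (Real.exp_pos (dotZ d b k)).le) h2
      linarith
  simp only [hterm, ENNReal.tsum_mul_right]
  have hs1 := summable_snd_mul_exp hμ hs b
  have hs2 := (hs b).mul_left (z.2 : ℝ)
  rw [← ENNReal.ofReal_tsum_of_nonneg hnn (hs1.add hs2), hs1.tsum_add hs2, tsum_mul_left,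
    mul_comm]
  refine mul_le_mul_right (ENNReal.ofReal_le_ofReal ?_) _
  have h1 := hb.1
  have h2 := hb.2
  rw [jgf] at h1
  rw [jgfDβ] at h2
  rw [h1]
  simp [toZ]
  exact h2

/-- An irreducible walk on `ℤ^d` whose last coordinate makes no jump below `-1` does jump
to `-1`. -/
lemma exists_jump_down (hμ : ∀ k, 0 ≤ μ k) (hH0 : H0 d μ μ0) (hH2 : H2 d μ) :
    ∃ x, 0 < μ (x, -1) := by
  by_contra! h
  have hneg : ∀ k : Zd d, k.2 < 0 → μ k = 0 := by
    rintro ⟨x, y⟩ hk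
    rcases lt_or_eq_of_le (show y ≤ -1 by simp at hk; omega) with h' | rfl
    · exact hH0.1 _ h'
    · exact le_antisymm (h x) (hμ _)
  have key : ∀ n (z z' : Zd d), z'.2 < z.2 → stepSn d μ n z z' = 0 := by
    intro n
    induction n with
    | zero =>
      intro z z' hlt
      have : z ≠ z' := by
        rintro rfl
        exact lt_irrefl _ hlt
      simp [stepSn, kerIter, this]
    | succ n ih =>
      intro z z' hlt
      refine ENNReal.tsum_eq_zero.2 fun w => ?_
      by_cases hw : w.2 < z.2
      · rw [show kerIter (stepS d μ) n z w = 0 from ih z w hw, zero_mul]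
      · have : μ (z' - w) = 0 := hneg _ (by simp; omega)
        simp [stepS, this]
  obtain ⟨n, hn⟩ := hH2.1 (0, 0) (0, -1)
  rw [key n _ _ (by simp)] at hn
  exact lt_irrefl _ hn

lemma kerApply_shift {p : St d → St d → ℝ≥0∞} {t : Fin (d-1) → ℤ} {c : ℝ≥0∞}
    (hp : ∀ z w : St d, p (z.1 + t, z.2) (w.1 + t, w.2) = p z w) {f : St d → ℝ≥0∞}
    (hf : ∀ z : St d, f (z.1 + t, z.2) = c * f z) (z : St d) :
    kerApply p f (z.1 + t, z.2) = c * kerApply p f z := by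
  rw [kerApply, ← ((Equiv.addRight t).prodCongr (Equiv.refl ℕ)).tsum_eq, kerApply,
    ← ENNReal.tsum_mul_left]
  refine tsum_congr fun w => ?_
  have h1 := hp z w
  have h2 := hf w
  simp only [Equiv.prodCongr_apply, Prod.map, Equiv.coe_addRight, Equiv.refl_apply]
  rw [h1, h2, mul_left_comm]

lemma step_shift (t : Fin (d-1) → ℤ) (z w : St d) :
    step d μ μ0 (z.1 + t, z.2) (w.1 + t, w.2) = step d μ μ0 z w := by
  simp [step, toZ]

lemma stepKilled_shift (t : Fin (d-1) → ℤ) (z w : St d) :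
    stepKilled d μ μ0 (z.1 + t, z.2) (w.1 + t, w.2) = stepKilled d μ μ0 z w := by
  simp only [stepKilled, step_shift]

lemma expDot_shift (b : Rd d) (t : Fin (d-1) → ℤ) (z : St d) :
    expDot d b (toZ d (z.1 + t, z.2)) = expDot d b (t, 0) * expDot d b (toZ d z) := by
  rw [← expDot_add]
  congr 1
  ext <;> simp [toZ, add_comm]

lemma kerApply_step_eq_add (f g : St d → ℝ≥0∞) (z : St d) :
    kerApply (step d μ μ0) (fun w => if w.2 = 0 then f w else g w) z
      = kerApply (step d μ μ0) (fun w => if w.2 = 0 then f w else 0) z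
        + kerApply (stepKilled d μ μ0) g z := by
  simp only [kerApply, ← ENNReal.tsum_add]
  refine tsum_congr fun w => ?_
  by_cases hw : w.2 = 0 <;> simp [stepKilled, hw]

/-- Minimum principle: a function of the last coordinate which is at least `1` at `0` and at
large heights, and is superharmonic for the kernel weighted by the harmonic function `h`, is
at least `1` everywhere, provided the walk can go down by one. -/
lemma one_le_of_superharmonic {p : St d → St d → ℝ≥0∞} {h : St d → ℝ≥0∞}
    (h0 : ∀ z, h z ≠ 0) (htop : ∀ z, h z ≠ ∞)
    (hharm : ∀ z : St d, z.2 ≠ 0 → kerApply p h z = h z)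
    (hdown : ∀ z : St d, z.2 ≠ 0 → ∃ w : St d, w.2 + 1 = z.2 ∧ p z w ≠ 0 ∧ p z w ≠ ∞)
    {k : ℕ → ℝ≥0∞} {L : ℕ} (hk0 : 1 ≤ k 0) (hkL : ∀ y, L ≤ y → 1 ≤ k y)
    (hk : ∀ z : St d, z.2 ≠ 0 → kerApply p (fun w => h w * k w.2) z ≤ h z * k z.2) (y : ℕ) :
    1 ≤ k y := by
  by_contra! hy
  have hyL : y < L := by
    by_contra! hL
    exact absurd (hkL y hL) (not_le.2 hy)
  obtain ⟨y₁, -, hmin⟩ := Finset.exists_min_image (Finset.range L) k ⟨y, by simpa using hyL⟩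
  have hy₁ : k y₁ < 1 := (hmin y (by simpa using hyL)).trans_lt hy
  have hall : ∀ y', k y₁ ≤ k y' := by
    intro y'
    by_cases h' : y' < L
    · exact hmin y' (by simpa using h')
    · exact hy₁.le.trans (hkL y' (not_lt.1 h'))
  classical
  have hex : ∃ n, k n ≤ k y₁ := ⟨y₁, le_rfl⟩
  have hs := Nat.find_spec hex
  have hlt := fun {m} => Nat.find_min hex (m := m)
  set s := Nat.find hex
  have hsne : s ≠ 0 := by
    intro hs0
    rw [hs0] at hs
    exact absurd (hk0.trans hs) (not_le.2 hy₁)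
  let z : St d := (0, s)
  obtain ⟨w, hw, hw0, hwt⟩ := hdown z hsne
  have hws : k y₁ < k w.2 := not_le.1 (hlt (by simp [z] at hw; omega))
  have hsum : ∑' w, p z w * (h w * k y₁) = h z * k y₁ := by
    simp only [← mul_assoc, ENNReal.tsum_mul_right]
    rw [← hharm z hsne, kerApply]
  have hfin : h z * k y₁ ≠ ∞ := ENNReal.mul_ne_top (htop z) (hy₁.trans ENNReal.one_lt_top).ne
  have hstrict : ∑' w, p z w * (h w * k y₁) < ∑' w, p z w * (h w * k w.2) := by
    refine ENNReal.tsum_lt_tsum (hsum ▸ hfin) (fun v => by gcongr; exact hall _) (i := w) ?_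
    exact ENNReal.mul_lt_mul_right hw0 hwt (ENNReal.mul_lt_mul_right (h0 w) (htop w) hws)
  rw [hsum] at hstrict
  exact absurd ((hk z hsne).trans (mul_le_mul_right hs _)) (not_le.2 hstrict)

/-- The tilted walk hits the boundary almost surely from the interior. -/
lemma potential_eq_expDot (hμ : ∀ k, 0 ≤ μ k) (hH0 : H0 d μ μ0) (hH2 : H2 d μ)
    (hs : ∀ b : Rd d, Summable fun k : Zd d => μ k * Real.exp (dotZ d b k)) {b : Rd d}
    (hb : b ∈ bdMinus d μ) {z : St d} (hz : z.2 ≠ 0) :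
    ∑' n, (kerApply (stepKilled d μ μ0))^[n]
        (kerApply (step d μ μ0) fun w => if w.2 = 0 then expDot d b (toZ d w) else 0) z
      = expDot d b (toZ d z) := by
  set h : St d → ℝ≥0∞ := fun w => expDot d b (toZ d w) with hh
  set B := kerApply (step d μ μ0) fun w => if w.2 = 0 then expDot d b (toZ d w) else 0 with hB
  set G : St d → ℝ≥0∞ := fun z => ∑' n, (kerApply (stepKilled d μ μ0))^[n] B z with hG
  have hharm : ∀ z : St d, z.2 ≠ 0 → kerApply (step d μ μ0) h z = h z := fun z hz =>
    kerApply_step_expDot_interior hμ hH0 (hs b) hb.1 hz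
  have hh0 : ∀ z, h z ≠ 0 := fun z => expDot_ne_zero b _
  have hht : ∀ z, h z ≠ ∞ := fun z => expDot_ne_top b _
  refine le_antisymm ?_ ?_
  · refine tsum_iterate_kerApply_le _ B h {z | z.2 ≠ 0} (fun z w hw h0 => hw ?_) (fun z hz => ?_)
      z hz
    · simp [stepKilled, h0]
    · rw [hB, ← kerApply_step_eq_add (fun w => expDot d b (toZ d w)) h]
      simp only [hh, ite_self]
      exact (hharm z hz).le
  · have hshift : ∀ t : Fin (d-1) → ℤ, ∀ z : St d,
        G (z.1 + t, z.2) = expDot d b (t, 0) * G z := by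
      intro t z
      simp only [hG, ← ENNReal.tsum_mul_left]
      refine tsum_congr fun n => ?_
      induction n generalizing z with
      | zero =>
        refine kerApply_shift (step_shift t) (fun w => ?_) z
        by_cases hw : w.2 = 0
        · simpa [hw] using expDot_shift b t w
        · simp [hw]
      | succ n ih =>
        simp only [Function.iterate_succ_apply']
        exact kerApply_shift (stepKilled_shift t) ih z
    let g : ℕ → ℝ≥0∞ := fun y => if y = 0 then 1 else G (0, y) / h (0, y)
    have hg : ∀ z : St d, h z * g z.2 = if z.2 = 0 then h z else G z := by
      intro z
      by_cases hz : z.2 = 0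
      · simp [g, hz]
      · have e1 : h z = expDot d b (z.1, 0) * h (0, z.2) := by
          simpa using expDot_shift b z.1 (0, z.2)
        have e2 : G z = expDot d b (z.1, 0) * G (0, z.2) := by
          simpa using hshift z.1 (0, z.2)
        simp only [g, hz, if_false]
        rw [e1, e2, mul_assoc, ENNReal.mul_div_cancel (hh0 _) (hht _)]
    have hdown : ∀ z : St d, z.2 ≠ 0 → ∃ w : St d, w.2 + 1 = z.2 ∧
        step d μ μ0 z w ≠ 0 ∧ step d μ μ0 z w ≠ ∞ := by
      intro z hz
      obtain ⟨x, hx⟩ := exists_jump_down hμ hH0 hH2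
      refine ⟨(z.1 + x, z.2 - 1), by simp; omega, ?_, ?_⟩
      · have : toZ d (z.1 + x, z.2 - 1) - toZ d z = (x, -1) := by
          ext <;> simp [toZ]
          omega
        simp [step, hz, this, hx]
      · simp [step, hz]
    have hgharm : ∀ z : St d, z.2 ≠ 0 →
        kerApply (step d μ μ0) (fun w => h w * g w.2) z = h z * g z.2 := by
      intro z hz
      simp only [hg, hz, if_false]
      rw [kerApply_step_eq_add]
      exact (tsum_iterate_kerApply _ B z).symm
    have hlower : ∀ n : ℕ, ∀ y : ℕ, 1 ≤ g y + ((n : ℝ≥0∞) + 1)⁻¹ * y := by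
      intro n
      refine one_le_of_superharmonic (L := n + 1)
        (k := fun y => g y + ((n : ℝ≥0∞) + 1)⁻¹ * y) hh0 hht hharm hdown ?_ ?_ ?_
      · simp [g]
      · intro y hy
        have hy' : (n : ℝ≥0∞) + 1 ≤ y := by exact_mod_cast hy
        calc (1 : ℝ≥0∞) = ((n : ℝ≥0∞) + 1)⁻¹ * (n + 1) :=
              (ENNReal.inv_mul_cancel (by simp) (by simp)).symm
          _ ≤ ((n : ℝ≥0∞) + 1)⁻¹ * y := by gcongr
          _ ≤ _ := le_add_self
      · intro z hz
        simp only [mul_add]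
        rw [kerApply_add, hgharm z hz]
        have := mul_le_mul_right (kerApply_step_snd_le (μ0 := μ0) hμ hH0 hs hb hz)
          ((n : ℝ≥0∞) + 1)⁻¹
        refine add_le_add_right ?_ _
        rw [mul_left_comm]
        refine le_trans (le_of_eq ?_) this
        rw [kerApply, kerApply, ← ENNReal.tsum_mul_left]
        refine tsum_congr fun w => ?_
        ring
    have hone : 1 ≤ g z.2 := by
      have hlim : Tendsto (fun n : ℕ => g z.2 + ((n : ℝ≥0∞) + 1)⁻¹ * (z.2 : ℝ≥0∞)) atTop
          (nhds (g z.2 + 0 * (z.2 : ℝ≥0∞))) := by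
        refine tendsto_const_nhds.add (ENNReal.Tendsto.mul_const ?_ (by simp))
        have := (tendsto_add_atTop_iff_nat 1).2 ENNReal.tendsto_inv_nat_nhds_zero
        simpa using this
      simpa using ge_of_tendsto' hlim fun n => hlower n z.2
    calc h z = h z * 1 := (mul_one _).symm
      _ ≤ h z * g z.2 := by gcongr
      _ = G z := by simp [hg, hz]

/-- Moments of the hitting distribution as potentials of the killed kernel. -/
lemma tsum_hitProb_mul (f : St d → ℝ≥0∞) (z : St d) :
    ∑' w, hitProb d μ μ0 z w * f w
      = ∑' n, (kerApply (stepKilled d μ μ0))^[n]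
          (kerApply (step d μ μ0) fun w => if w.2 = 0 then f w else 0) z := by
  have hw : ∀ w, hitProb d μ μ0 z w * f w
      = ∑' n, ∑' v, stepKilledn d μ μ0 n z v *
          (step d μ μ0 v w * if w.2 = 0 then f w else 0) := by
    intro w
    by_cases hw : w.2 = 0
    · simp only [hitProb, hw, if_true, ← ENNReal.tsum_mul_right, mul_assoc]
    · simp [hitProb, hw]
  simp only [hw]
  rw [ENNReal.tsum_comm]
  refine tsum_congr fun n => ?_
  rw [ENNReal.tsum_comm, ← tsum_kerIter_mul]
  simp only [ENNReal.tsum_mul_left]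
  rfl

end

/-- exponential moments of the hitting distribution of the boundary
hyperplane: `E_z[exp(a·Z(τ)); τ<∞] = exp(ā·z)` for interior `z` and
`= exp(ā·z)·φ₀(ā)` for boundary `z`. -/
theorem hitting_exponential_moment
    (d : ℕ) (hd : 2 ≤ d) (μ μ0 : Zd d → ℝ)
    (hμ : IsProb d μ) (hμ0 : IsProb d μ0)
    (hH0 : H0 d μ μ0) (hH1 : H1 d μ μ0) (hH2 : H2 d μ)
    (hH3 : H3 d μ μ0) (hH4 : H4 d μ μ0)
    (a abar : Rd d) (ha : a ∈ Dset d μ)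
    (habar : abar ∈ bdMinus d μ ∧ abar.1 = a.1) :
    ∀ z : St d,
      (z.2 ≠ 0 →
        ∑' w : St d,
            hitProb d μ μ0 z w * ENNReal.ofReal (Real.exp (dotZ d a (toZ d w)))
          = ENNReal.ofReal (Real.exp (dotZ d abar (toZ d z)))) ∧
      (z.2 = 0 →
        ∑' w : St d,
            hitProb d μ μ0 z w * ENNReal.ofReal (Real.exp (dotZ d a (toZ d w)))
          = ENNReal.ofReal (Real.exp (dotZ d abar (toZ d z)) * jgf d μ0 abar)) := by
  have hs : ∀ b : Rd d, Summable fun k : Zd d => μ k * Real.exp (dotZ d b k) :=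
    fun b => (hH4 b).1
  intro z
  have hsum : ∑' w : St d,
      hitProb d μ μ0 z w * ENNReal.ofReal (Real.exp (dotZ d a (toZ d w)))
      = ∑' n, (kerApply (stepKilled d μ μ0))^[n]
          (kerApply (step d μ μ0) fun w => if w.2 = 0 then expDot d abar (toZ d w) else 0) z := by
    rw [← tsum_hitProb_mul fun w => expDot d abar (toZ d w)]
    refine tsum_congr fun w => ?_
    by_cases hw : w.2 = 0
    · simp [expDot, dotZ, toZ, hw, habar.2]
    · simp [hitProb, hw]
  rw [hsum]
  refine ⟨fun hz => potential_eq_expDot hμ.1 hH0 hH2 hs habar.1 hz, fun hz => ?_⟩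
  rw [tsum_iterate_kerApply, ENNReal.ofReal_mul (Real.exp_pos _).le]
  refine Eq.trans ?_ (kerApply_step_expDot_boundary (μ := μ) hμ0.1 hH0 (hH4 abar).2 hz)
  rw [← kerApply_step_eq_add]
  refine tsum_congr fun w => ?_
  by_cases hw : w.2 = 0
  · simp [hw]
  · simp only [hw, if_false]
    rw [potential_eq_expDot hμ.1 hH0 hH2 hs habar.1 hw]

end ReflectedRW
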